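/- A multiset of fixed point data with exactly 2 elements is achievable if and only if it equals {(+1, {a, b}), (−1, {a, b})} for some relatively prime positive integers a and b. -/

import Mathlib

/-- A fixed point datum: a sign (an integer, intended to be `±1`) together with
an unordered pair (a multiset with two elements) of positive integers. -/
abbrev FPDatum : Type := ℤ × Multiset ℕ+

/-- A finite multiset of fixed point data is achievable if it can be obtained
from the empty multiset by finitely many applications of the steps:
(1) add `(+1, {a, b})` and `(-1, {a, b})` for relatively prime positive `a`, `b`;
(2) replace `(+1, {c, d})` by `(+1, {c, c+d})` and `(+1, {d, c+d})`;
(3) replace `(-1, {e, f})` by `(-1, {e, e+f})` and `(-1, {f, e+f})`. -/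
inductive Achievable : Multiset FPDatum → Prop
  | empty : Achievable 0
  | add {M : Multiset FPDatum} (a b : ℕ+) (hab : Nat.Coprime a b) (hM : Achievable M) :
      Achievable ((1, ({a, b} : Multiset ℕ+)) ::ₘ (-1, ({a, b} : Multiset ℕ+)) ::ₘ M)
  | blowupPos {M : Multiset FPDatum} (c d : ℕ+)
      (hM : Achievable ((1, ({c, d} : Multiset ℕ+)) ::ₘ M)) :
      Achievable ((1, ({c, c + d} : Multiset ℕ+)) ::ₘ (1, ({d, c + d} : Multiset ℕ+)) ::ₘ M)
  | blowupNeg {M : Multiset FPDatum} (e f : ℕ+)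
      (hM : Achievable ((-1, ({e, f} : Multiset ℕ+)) ::ₘ M)) :
      Achievable ((-1, ({e, e + f} : Multiset ℕ+)) ::ₘ (-1, ({f, e + f} : Multiset ℕ+)) ::ₘ M)

/-- The number of elements with sign `+1` minus the number of elements with sign `-1`. -/
def signedCount (M : Multiset FPDatum) : ℤ :=
  ((M.countP fun x => x.1 = 1 : ℕ) : ℤ) - ((M.countP fun x => x.1 = -1 : ℕ) : ℤ)

theorem Achievable.card_ne_one {M : Multiset FPDatum} (h : Achievable M) : M.card ≠ 1 := by
  cases h <;> simp

theorem stmt4 (M : Multiset FPDatum) (hcard : M.card = 2) :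
    Achievable M ↔
      ∃ a b : ℕ+, Nat.Coprime a b ∧
        M = {(1, ({a, b} : Multiset ℕ+)), (-1, ({a, b} : Multiset ℕ+))} := by
  constructor
  · intro h
    cases h with
    | empty => simp at hcard
    | @add N a b hab hN =>
      have h0 : N = 0 := by
        rw [← Multiset.card_eq_zero]
        simpa using hcard
      subst h0
      exact ⟨a, b, hab, rfl⟩
    | @blowupPos N c d hN =>
      exact absurd (by simpa using hcard) hN.card_ne_one
    | @blowupNeg N e f hN =>
      exact absurd (by simpa using hcard) hN.card_ne_one
  · rintro ⟨a, b, hab, rfl⟩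
    exact Achievable.add a b hab Achievable.empty
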